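/- Let E ⊆ L be an extension of finite fields and let φ : Lˣ → ℂˣ be a group homomorphism. Then the following are equivalent: (i) there exists a group homomorphism ψ : Eˣ → ℂˣ such that φ(x) = ψ(N_{L/E}(x)) for all x ∈ Lˣ; (ii) φ(x)^(|E|−1) = 1 for all x ∈ Lˣ. -/

import Mathlib

/-- In a finite cyclic group of order `m * n`, every element killed by `m` is an `n`-th power. -/
theorem IsCyclic.exists_pow_eq_of_pow_eq_one {G : Type*} [Group G] [IsCyclic G] {m n : ℕ}
    (hm : m ≠ 0) (hcard : Nat.card G = m * n) {x : G} (hx : x ^ m = 1) :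
    ∃ y : G, y ^ n = x := by
  obtain ⟨g, hg⟩ := IsCyclic.exists_generator (α := G)
  obtain ⟨k, rfl⟩ := Subgroup.mem_zpowers_iff.mp (hg x)
  rw [← zpow_natCast, ← zpow_mul, ← orderOf_dvd_iff_zpow_eq_one,
    orderOf_eq_card_of_forall_mem_zpowers hg, hcard, Nat.cast_mul, mul_comm k] at hx
  obtain ⟨l, rfl⟩ := Int.dvd_of_mul_dvd_mul_left (by exact_mod_cast hm) hx
  exact ⟨g ^ l, by rw [← zpow_natCast, ← zpow_mul, mul_comm]⟩

/-- In an extension of finite fields, every unit of norm one is a `(|E| - 1)`-th power. -/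
theorem FiniteField.exists_pow_card_sub_one_eq_of_norm_eq_one {E L : Type*} [Field E] [Field L]
    [Algebra E L] [Fintype E] [Finite L] {x : Lˣ}
    (hx : Units.map (Algebra.norm E : L →* E) x = 1) :
    ∃ y : Lˣ, y ^ (Fintype.card E - 1) = x := by
  have hdvd : Nat.card E - 1 ∣ Nat.card L - 1 := by
    rw [Module.natCard_eq_pow_finrank (K := E) (V := L)]
    exact Nat.sub_one_dvd_pow_sub_one _ _
  have hmul := Nat.div_mul_cancel hdvd
  have hL : Nat.card L - 1 ≠ 0 := Nat.sub_ne_zero_of_lt Finite.one_lt_card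
  rw [← Nat.card_eq_fintype_card]
  refine IsCyclic.exists_pow_eq_of_pow_eq_one (m := (Nat.card L - 1) / (Nat.card E - 1)) ?_ ?_ ?_
  · intro h
    rw [h, zero_mul] at hmul
    exact hL hmul.symm
  · rw [Nat.card_units, hmul]
  · have hnorm : Algebra.norm E (x : L) = 1 := congrArg Units.val hx
    ext
    rw [Units.val_pow_eq_pow_val, Units.val_one, ← FiniteField.algebraMap_norm_eq_pow,
      hnorm, map_one]

/-- Let `E ⊆ L` be an extension of finite fields and `φ : Lˣ → ℂˣ` a
group homomorphism.  Then `φ` factors through the norm map `N_{L/E} : Lˣ → Eˣ` (i.e.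
there is a group homomorphism `ψ : Eˣ → ℂˣ` with `φ x = ψ (N_{L/E} x)` for all `x`)
if and only if `φ(x) ^ (|E| - 1) = 1` for all `x ∈ Lˣ`. -/
theorem factors_through_norm_iff_pow_card_sub_one_eq_one
    (E L : Type) [Field E] [Field L] [Algebra E L] [Fintype E] [Fintype L]
    (φ : Lˣ →* ℂˣ) :
    (∃ ψ : Eˣ →* ℂˣ, ∀ x : Lˣ,
        φ x = ψ (Units.map (Algebra.norm E : L →* E) x)) ↔
      (∀ x : Lˣ, φ x ^ (Fintype.card E - 1) = 1) := by
  constructor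
  · rintro ⟨ψ, hψ⟩ x
    rw [hψ, ← map_pow, ← Nat.card_eq_fintype_card, ← Nat.card_units, pow_card_eq_one', map_one]
  · intro h
    have hker : (Units.map (Algebra.norm E : L →* E)).ker ≤ φ.ker := by
      intro x hx
      obtain ⟨y, rfl⟩ := FiniteField.exists_pow_card_sub_one_eq_of_norm_eq_one hx
      rw [MonoidHom.mem_ker, map_pow, h]
    refine ⟨MonoidHom.liftOfSurjective _ (FiniteField.unitsMap_norm_surjective E L) ⟨φ, hker⟩,
      fun x ↦ ?_⟩
    exact (MonoidHom.liftOfRightInverse_comp_apply _ _ _ ⟨φ, hker⟩ x).symm
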